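/- Let L be a finite-dimensional semisimple Lie algebra over ℂ and let φ : L → L be a Lie algebra automorphism with φ ∘ φ = id, with +1-eigenspace L₀ and −1-eigenspace L₁. Then every nonzero element e ∈ L₁ such that ad(e) is a nilpotent endomorphism of L can be embedded in a homogeneous sl₂-triple: there exist h ∈ L₀ and f ∈ L₁ with ⁅h,e⁆ = 2•e, ⁅h,f⁆ = (−2)•f and ⁅e,f⁆ = h. -/

import Mathlib

section JacobsonMorozov

/-- If `⁅a, x⁆` commutes with `a`, it also satisfies the Leibniz rule for powers of `a`. -/
theorem pow_mul_eq_of_commute_commutator {R : Type*} [Ring R] {a x c : R}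
    (hc : a * x = x * a + c) (hac : Commute a c) (n : ℕ) :
    a ^ (n + 1) * x = x * a ^ (n + 1) + (n + 1 : ℕ) • (c * a ^ n) := by
  induction n with
  | zero => simp [hc]
  | succ n ih =>
    have h₁ : a * (c * a ^ n) = c * a ^ (n + 1) := by
      rw [← mul_assoc, hac.eq, mul_assoc, pow_succ']
    rw [pow_succ' a (n + 1), mul_assoc, ih, mul_add, ← mul_assoc a x, hc, mul_smul_comm, h₁,
      add_mul, mul_assoc x, succ_nsmul _ (n + 1)]
    abel

/-- **Jacobson's lemma**: if `a` is nilpotent and commutes with `c = a * x - x * a`, then `c` is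
nilpotent. -/
theorem isNilpotent_of_commute_commutator {R : Type*} [Ring R] [IsAddTorsionFree R] {a x c : R}
    (hc : a * x = x * a + c) (hac : Commute a c) (ha : IsNilpotent a) : IsNilpotent c := by
  obtain ⟨n, hn⟩ := ha
  suffices ∀ m k, c ^ k * a ^ m = 0 → IsNilpotent c from this n 0 (by simp [hn])
  intro m
  induction m with
  | zero => exact fun k hk ↦ ⟨k, by simpa using hk⟩
  | succ m ih =>
    intro k hk
    refine ih (k + 1 + k) ?_
    have h₁ := congr(c ^ k * $(pow_mul_eq_of_commute_commutator hc hac m) * c ^ k)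
    have h₂ : a ^ (m + 1) * c ^ k = 0 := by rw [(hac.pow_pow _ _).eq, hk]
    rw [← mul_assoc, hk, zero_mul, zero_mul, mul_add, add_mul, mul_assoc _ (x * _), mul_assoc x, h₂,
      mul_zero, mul_zero, zero_add, mul_smul_comm, smul_mul_assoc] at h₁
    have h₃ := (smul_eq_zero.mp h₁.symm).resolve_left (Nat.succ_ne_zero m)
    rw [pow_add, pow_succ, mul_assoc _ (c ^ k), ← (hac.pow_pow m k).eq, ← h₃]
    simp only [mul_assoc]

/-- If `a` is a nilpotent endomorphism commuting with `c = a * x - x * a`, then `a * x` is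
nilpotent. -/
theorem Module.End.isNilpotent_mul_of_commute_commutator {R M : Type*} [CommRing R]
    [AddCommGroup M] [Module R M] [IsAddTorsionFree (Module.End R M)] {a x c : Module.End R M}
    (hc : a * x = x * a + c) (hac : Commute a c) (ha : IsNilpotent a) : IsNilpotent (a * x) := by
  obtain ⟨k, hk⟩ := isNilpotent_of_commute_commutator hc hac ha
  obtain ⟨n, hn⟩ := ha
  have key (n : ℕ) : a ^ n * (a * x) = x * a ^ (n + 1) + (n + 1 : ℕ) • (c * a ^ n) := by
    rw [← mul_assoc, ← pow_succ, pow_mul_eq_of_commute_commutator hc hac]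
  suffices ∀ n (v : M), (a ^ n) v = 0 → ((a * x) ^ (k * n)) v = 0 from
    ⟨k * n, LinearMap.ext fun v ↦ this n v (by simp [hn])⟩
  intro n
  induction n with
  | zero => intro v hv; simpa using hv
  | succ n ih =>
    intro v hv
    have h₁ (j : ℕ) : (a ^ (n + 1)) (((a * x) ^ j) v) = 0 ∧
        (a ^ n) (((a * x) ^ j) v) = ((n + 1) ^ j : ℕ) • (c ^ j) ((a ^ n) v) := by
      induction j with
      | zero => simpa using hv
      | succ j ihj =>
        have h₂ := congr($(key (n + 1)) (((a * x) ^ j) v))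
        have h₃ := congr($(key n) (((a * x) ^ j) v))
        rw [Module.End.mul_apply, LinearMap.add_apply, Module.End.mul_apply x, LinearMap.smul_apply,
          Module.End.mul_apply c] at h₂ h₃
        rw [pow_succ' a (n + 1), Module.End.mul_apply a (a ^ (n + 1)), ihj.1] at h₂
        rw [ihj.1, ihj.2] at h₃
        rw [pow_succ' (a * x), Module.End.mul_apply (a * x)]
        refine ⟨by simpa using h₂, ?_⟩
        rw [h₃, map_zero, zero_add, map_nsmul, smul_smul, pow_succ' c, Module.End.mul_apply,
          pow_succ']
    rw [Nat.mul_succ, pow_add, Module.End.mul_apply]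
    exact ih _ (by rw [(h₁ k).2, hk]; simp)

variable {K L : Type*} [Field K] [CharZero K] [LieRing L] [LieAlgebra K L]

open LieAlgebra

attribute [local instance] LieRing.ofAssociativeRing in
/-- An `ad`-nilpotent element is orthogonal to the kernel of the square of its adjoint action. -/
theorem killingForm_eq_zero_of_lie_lie_eq_zero {e x : L} (hnil : IsNilpotent (ad K L e))
    (hx : ⁅e, ⁅e, x⁆⁆ = 0) : killingForm K L e x = 0 := by
  have : IsAddTorsionFree (Module.End K L) := .of_isTorsionFree K _
  rw [killingForm_apply_apply]
  refine (LinearMap.isNilpotent_trace_of_isNilpotent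
    (Module.End.isNilpotent_mul_of_commute_commutator (c := ad K L ⁅e, x⁆) ?_ ?_ hnil)).eq_zero
  · rw [LieHom.map_lie, Ring.lie_def]; abel
  · rw [commute_iff_lie_eq, ← LieHom.map_lie, hx, map_zero]

/-- In a Lie algebra with nondegenerate Killing form, an `ad`-nilpotent element `e` belongs to the
range of `(ad e) ^ 2`. -/
theorem exists_lie_lie_eq_self [FiniteDimensional K L] [IsKilling K L] {e : L}
    (hnil : IsNilpotent (ad K L e)) :
    ∃ y : L, ⁅e, ⁅e, y⁆⁆ = e := by
  suffices e ∈ LinearMap.range (ad K L e * ad K L e) from this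
  by_contra he
  obtain ⟨g, hg, hle⟩ := Submodule.exists_le_ker_of_notMem he
  have hB := IsKilling.killingForm_nondegenerate K L
  obtain ⟨y, rfl⟩ := (LinearMap.BilinForm.toDual (killingForm K L) hB).surjective g
  simp only [LinearMap.BilinForm.toDual_def] at hg
  refine hg ?_
  rw [LieModule.traceForm_comm]
  refine killingForm_eq_zero_of_lie_lie_eq_zero hnil (hB.1 _ fun z ↦ ?_)
  have h := hle ⟨z, rfl⟩
  simp only [LinearMap.mem_ker, LinearMap.BilinForm.toDual_def, Module.End.mul_apply,
    ad_apply] at h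
  rwa [LieModule.traceForm_apply_lie_apply', LieModule.traceForm_apply_lie_apply', neg_neg]

omit [CharZero K] in
/-- Commutation relation between powers of `ad e` and `ad f`, where `h = ⁅e, f⁆` satisfies
`⁅h, e⁆ = 2 • e`. -/
theorem ad_pow_succ_lie_eq {e f h : L} (hef : ⁅e, f⁆ = h) (hhe : ⁅h, e⁆ = (2 : K) • e)
    (n : ℕ) (u : L) :
    (ad K L e ^ (n + 1)) ⁅f, u⁆ = ⁅f, (ad K L e ^ (n + 1)) u⁆ +
      (n + 1 : K) • (⁅h, (ad K L e ^ n) u⁆ - (n : K) • (ad K L e ^ n) u) := by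
  induction n with
  | zero => simp [← hef]
  | succ n ih =>
    have h₁ (v : L) : ⁅e, ⁅f, v⁆⁆ = ⁅h, v⁆ + ⁅f, ⁅e, v⁆⁆ := by rw [← hef, leibniz_lie]
    have h₂ (v : L) : ⁅e, ⁅h, v⁆⁆ = ⁅h, ⁅e, v⁆⁆ - (2 : K) • ⁅e, v⁆ := by
      rw [leibniz_lie h, hhe, smul_lie]; abel
    rw [pow_succ' _ (n + 1), Module.End.mul_apply, ih, map_add, map_smul, map_sub, map_smul]
    simp only [Module.End.mul_apply, ad_apply, h₁, h₂, pow_succ' _ n]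
    push_cast
    module

/-- If `h = ⁅e, f⁆` and `⁅h, e⁆ = 2 • e` with `e` `ad`-nilpotent, then `ad h` does not have the
eigenvalue `-2` on the centralizer of `e`. -/
theorem eq_zero_of_lie_eq_neg_two_smul {e f h : L} (hnil : IsNilpotent (ad K L e))
    (hef : ⁅e, f⁆ = h) (hhe : ⁅h, e⁆ = (2 : K) • e) {v : L} (hev : ⁅e, v⁆ = 0)
    (hhv : ⁅h, v⁆ = (-2 : K) • v) : v = 0 := by
  have key (n : ℕ) : v ∈ LinearMap.range (ad K L e ^ n) := by
    induction n with
    | zero => simp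
    | succ n ih =>
      obtain ⟨u, hu⟩ := ih
      have h₁ := ad_pow_succ_lie_eq hef hhe n u
      rw [pow_succ' _ n, Module.End.mul_apply (ad K L e) _ u, hu, ad_apply, hev, lie_zero, zero_add,
        hhv, ← sub_smul, smul_smul] at h₁
      have h₂ : (n + 1 : K) * (-2 - n) ≠ 0 := by
        have : (n + 2 : K) ≠ 0 := by exact_mod_cast Nat.succ_ne_zero (n + 1)
        refine mul_ne_zero n.cast_add_one_ne_zero fun h ↦ this ?_
        linear_combination -h
      rw [← Submodule.smul_mem_iff _ h₂, ← h₁, pow_succ']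
      exact ⟨_, rfl⟩
  obtain ⟨n, hn⟩ := hnil
  simpa [hn] using key n

/-- **Morozov's lemma**: if `h = ⁅e, f₀⁆` and `⁅h, e⁆ = 2 • e` with `e` `ad`-nilpotent, then `e` and
`h` can be completed to an `sl₂`-triple. -/
theorem exists_lie_eq_and_lie_eq_neg_two_smul [FiniteDimensional K L] {e f₀ h : L}
    (hnil : IsNilpotent (ad K L e)) (hef : ⁅e, f₀⁆ = h) (hhe : ⁅h, e⁆ = (2 : K) • e) :
    ∃ f : L, ⁅e, f⁆ = h ∧ ⁅h, f⁆ = (-2 : K) • f := by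
  have h₂ (v : L) : ⁅e, ⁅h, v⁆⁆ = ⁅h, ⁅e, v⁆⁆ - (2 : K) • ⁅e, v⁆ := by
    rw [leibniz_lie h, hhe, smul_lie]; abel
  let T : Module.End K L := ad K L h + (2 : K) • 1
  have hT : ∀ v ∈ LinearMap.ker (ad K L e), T v ∈ LinearMap.ker (ad K L e) := fun v hv ↦ by
    have hv' : ⁅e, v⁆ = 0 := hv
    simp [T, h₂, hv']
  have hinj : Function.Injective (T.restrict hT) := by
    rw [injective_iff_map_eq_zero]
    rintro ⟨v, hv⟩ h0
    have h0' : ⁅h, v⁆ + (2 : K) • v = 0 := congr_arg Subtype.val h0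
    ext
    refine eq_zero_of_lie_eq_neg_two_smul hnil hef hhe hv ?_
    rw [neg_smul, eq_neg_iff_add_eq_zero, h0']
  have hw : T f₀ ∈ LinearMap.ker (ad K L e) := by simp [T, h₂, hef]
  obtain ⟨⟨z, hz⟩, hzw⟩ := LinearMap.surjective_of_injective hinj ⟨T f₀, hw⟩
  have hz' : ⁅e, z⁆ = 0 := hz
  have hzw' : ⁅h, z⁆ + (2 : K) • z = ⁅h, f₀⁆ + (2 : K) • f₀ := congr_arg Subtype.val hzw
  refine ⟨f₀ - z, by simp [hef, hz'], ?_⟩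
  rw [lie_sub, eq_sub_of_add_eq hzw']
  module

end JacobsonMorozov


/-- Let `L` be a finite-dimensional semisimple Lie algebra over `ℂ` (semisimplicity is encoded
by the nondegeneracy of the Killing form, `LieAlgebra.IsKilling`), and let `φ` be an involutive
automorphism of `L`.  Every nonzero `e` with `φ e = −e` (i.e. `e ∈ L₁`) whose adjoint action is
nilpotent embeds in a homogeneous `sl₂`-triple: there are `h` with `φ h = h` (i.e. `h ∈ L₀`) and
`f` with `φ f = −f` (i.e. `f ∈ L₁`) such that `⁅h,e⁆ = 2•e`, `⁅h,f⁆ = (−2)•f`, `⁅e,f⁆ = h`. -/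
theorem exists_homogeneous_sl2_triple_complex
    (L : Type*) [LieRing L] [LieAlgebra ℂ L] [FiniteDimensional ℂ L]
    [LieAlgebra.IsKilling ℂ L]
    (φ : L →ₗ⁅ℂ⁆ L) (hφ : ∀ x, φ (φ x) = x)
    (e : L) (he : e ≠ 0) (heφ : φ e = -e)
    (hnil : IsNilpotent (LieAlgebra.ad ℂ L e)) :
    ∃ h f : L, φ h = h ∧ φ f = -f ∧
      ⁅h, e⁆ = (2 : ℂ) • e ∧ ⁅h, f⁆ = (-2 : ℂ) • f ∧ ⁅e, f⁆ = h := by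
  obtain ⟨y, hy⟩ := exists_lie_lie_eq_self hnil
  have hyφ : ⁅e, ⁅e, φ y⁆⁆ = -e := by
    have := congr_arg φ hy
    rwa [LieHom.map_lie, LieHom.map_lie, heφ, neg_lie, neg_lie, lie_neg, neg_neg] at this
  obtain ⟨f₀, hf₀⟩ : ∃ f₀, f₀ = φ y - y := ⟨_, rfl⟩
  obtain ⟨h, hh⟩ : ∃ h, ⁅e, f₀⁆ = h := ⟨_, rfl⟩
  have hφh : φ h = h := by
    rw [← hh, hf₀, LieHom.map_lie, heφ, map_sub, hφ, neg_lie, ← lie_neg, neg_sub]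
  have hhe : ⁅h, e⁆ = (2 : ℂ) • e := by
    rw [← lie_skew, ← hh, hf₀, lie_sub, lie_sub, hy, hyφ]
    module
  obtain ⟨f, hef, hhf⟩ := exists_lie_eq_and_lie_eq_neg_two_smul hnil hh hhe
  have hef' : ⁅e, φ f⁆ = -h := by
    have := congr_arg φ hef
    rw [LieHom.map_lie, heφ, hφh, neg_lie] at this
    rw [← this, neg_neg]
  have hhf' : ⁅h, φ f⁆ = (-2 : ℂ) • φ f := by
    have := congr_arg φ hhf
    rwa [LieHom.map_lie, hφh, map_smul] at this
  refine ⟨h, (2⁻¹ : ℂ) • (f - φ f), hφh, ?_, hhe, ?_, ?_⟩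
  · rw [map_smul, map_sub, hφ]
    module
  · rw [lie_smul, lie_sub, hhf, hhf']
    module
  · rw [lie_smul, lie_sub, hef, hef']
    module
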